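/- arXiv:0809.2166 — 2 statements merged into one kernel-verified Lean document; each statement's English description precedes it below -/
import Mathlib

section
/- Let p be an odd prime and let F be a field of characteristic different from p containing a primitive p-th root of unity, with absolute Galois group G = G_F. Then every continuous surjective group homomorphism ψ : G → ℤ/p factors in one of the following two ways: (i) there exists a continuous surjective homomorphism Φ : G → ℤ/p² with ψ = π ∘ Φ, where π : ℤ/p² → ℤ/p is the reduction homomorphism; or (ii) there exists a continuous surjective homomorphism Φ : G → M_{p³} with ψ = λ'' ∘ Φ, where λ'' : M_{p³} → ℤ/p is the homomorphism sending (i,j) ∈ (ℤ/p²) ⋊ (ℤ/p) to i mod p. -/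
/-- `(1+p)^p = 1` in `ZMod (p^2)`. -/
lemma one_add_p_pow_p (p : ℕ) : (1 + (p : ZMod (p ^ 2))) ^ p = 1 := by
  have h0 : ((p : ZMod (p ^ 2))) ^ 2 = 0 := by
    have : ((p ^ 2 : ℕ) : ZMod (p ^ 2)) = 0 := ZMod.natCast_self _
    push_cast at this
    exact this
  rw [add_comm, add_pow]
  rw [Finset.sum_eq_single 0]
  · simp
  · intro b _ hb0
    rcases Nat.lt_or_ge b 2 with h2 | h2
    · have hb1 : b = 1 := by omega
      subst hb1
      have : ((p.choose 1 : ℕ) : ZMod (p ^ 2)) = (p : ZMod (p ^ 2)) := by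
        rw [Nat.choose_one_right]
      rw [this, pow_one, one_pow, mul_one, ← sq, h0]
    · have : ((p : ZMod (p ^ 2))) ^ b = 0 := by
        have : (p : ZMod (p ^ 2)) ^ b = (p : ZMod (p ^ 2)) ^ 2 * (p : ZMod (p ^ 2)) ^ (b - 2) := by
          rw [← pow_add]; congr 1; omega
        rw [this, h0, zero_mul]
      rw [this, zero_mul, zero_mul]
  · intro h
    exact absurd (Finset.mem_range.mpr (Nat.succ_pos p)) h

/-- The modular group `M_{p³}` of order `p³` and exponent `p²`, realized as the semidirect
product `(ℤ/p²) ⋊ (ℤ/p)` in which `j : ℤ/p` acts on `ℤ/p²` as multiplication by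
`(1+p)^j`.  An element `(i, j)` is recorded as `⟨i, j⟩`. -/
structure Mp3 (p : ℕ) where
  fst : ZMod (p ^ 2)
  snd : ZMod p

namespace Mp3

variable {p : ℕ}

/-- The action of `j : ℤ/p` on `ℤ/p²`: multiplication by `(1+p)^j`. -/
def act (p : ℕ) (j : ZMod p) : ZMod (p ^ 2) := (1 + (p : ZMod (p ^ 2))) ^ j.val

lemma pow_val_mod (p a : ℕ) :
    (1 + (p : ZMod (p ^ 2))) ^ (a % p) = (1 + (p : ZMod (p ^ 2))) ^ a := by
  conv_rhs => rw [← Nat.div_add_mod a p]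
  rw [pow_add, pow_mul, one_add_p_pow_p, one_pow, one_mul]

lemma act_zero [NeZero p] : act p (0 : ZMod p) = 1 := by
  rw [act, ZMod.val_zero, pow_zero]

lemma act_add [NeZero p] (j j' : ZMod p) : act p (j + j') = act p j * act p j' := by
  rw [act, act, act, ZMod.val_add, pow_val_mod, pow_add]

instance [NeZero p] : Mul (Mp3 p) :=
  ⟨fun x y => ⟨x.fst + act p x.snd * y.fst, x.snd + y.snd⟩⟩

instance : One (Mp3 p) := ⟨⟨0, 0⟩⟩

instance [NeZero p] : Inv (Mp3 p) :=
  ⟨fun x => ⟨-(act p (-x.snd) * x.fst), -x.snd⟩⟩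

lemma mul_def [NeZero p] (x y : Mp3 p) :
    x * y = ⟨x.fst + act p x.snd * y.fst, x.snd + y.snd⟩ := rfl

lemma one_def : (1 : Mp3 p) = ⟨0, 0⟩ := rfl

lemma inv_def [NeZero p] (x : Mp3 p) : x⁻¹ = ⟨-(act p (-x.snd) * x.fst), -x.snd⟩ := rfl

instance [NeZero p] : Group (Mp3 p) where
  mul_assoc x y z := by
    rcases x with ⟨a, b⟩; rcases y with ⟨c, d⟩; rcases z with ⟨e, f⟩
    simp only [mul_def, mk.injEq]
    refine ⟨?_, add_assoc _ _ _⟩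
    rw [act_add]
    ring
  one_mul x := by
    rcases x with ⟨a, b⟩
    simp only [one_def, mul_def, mk.injEq, act_zero, one_mul, zero_add]
  mul_one x := by
    rcases x with ⟨a, b⟩
    simp only [one_def, mul_def, mk.injEq, mul_zero, add_zero]
  inv_mul_cancel x := by
    rcases x with ⟨a, b⟩
    simp only [inv_def, mul_def, one_def, mk.injEq, neg_add_cancel]

instance : TopologicalSpace (Mp3 p) := ⊥

end Mp3

instance (n : ℕ) : TopologicalSpace (ZMod n) := ⊥

/-- The absolute Galois group of `F`, carrying the Krull topology. -/
abbrev Gal (F : Type*) [Field F] : Type _ := AlgebraicClosure F ≃ₐ[F] AlgebraicClosure F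

namespace Mp3Aux

/-- Reduction mod `p`. -/
def red (p : ℕ) : ZMod (p ^ 2) →+* ZMod p :=
  ZMod.castHom (dvd_pow_self p (by norm_num : (2 : ℕ) ≠ 0)) (ZMod p)

lemma psq (p : ℕ) : (p : ZMod (p ^ 2)) * p = 0 := by
  have : ((p ^ 2 : ℕ) : ZMod (p ^ 2)) = 0 := ZMod.natCast_self _
  push_cast at this
  rw [← sq]; exact this

lemma red_eq_zero (p : ℕ) [Fact p.Prime] (t : ZMod (p ^ 2)) (h : red p t = 0) :
    ∃ s, t = p * s := by
  have hp : p ≠ 0 := (Fact.out : p.Prime).ne_zero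
  have : NeZero (p ^ 2) := ⟨pow_ne_zero _ hp⟩
  have ht := ZMod.natCast_zmod_val t
  rw [← ht, map_natCast, ZMod.natCast_eq_zero_iff] at h
  obtain ⟨s, hs⟩ := h
  refine ⟨s, ?_⟩
  rw [← ht, hs]; push_cast; rfl

lemma one_add_pow (p n : ℕ) : (1 + (p : ZMod (p ^ 2))) ^ n = 1 + p * n := by
  induction n with
  | zero => simp
  | succ n ih =>
    rw [pow_succ _ n, ih]; push_cast
    linear_combination (n : ZMod (p ^ 2)) * psq p

lemma act_natCast (p n : ℕ) : Mp3.act p (n : ZMod p) = 1 + p * n := by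
  rw [Mp3.act, ZMod.val_natCast, Mp3.pow_val_mod, one_add_pow]

lemma red_p (p : ℕ) : red p (p : ZMod (p ^ 2)) = 0 := by simp

lemma red_act (p : ℕ) (j : ZMod p) : red p (Mp3.act p j) = 1 := by
  rw [Mp3.act, one_add_pow]; simp

lemma red_unit (p : ℕ) [Fact p.Prime] (t : ZMod (p ^ 2)) (h : red p t = 1) :
    ∃ w, w * t = 1 := by
  obtain ⟨s, hs⟩ := red_eq_zero p (t - 1) (by simp [h])
  refine ⟨1 - p * s, ?_⟩
  have : t = 1 + p * s := by rw [← hs]; ring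
  rw [this]; linear_combination (- s * s) * psq p

variable (p : ℕ) [Fact p.Prime]

/-- first coordinate mod `p` -/
def fstHom : Mp3 p →* Multiplicative (ZMod p) where
  toFun x := Multiplicative.ofAdd (red p x.fst)
  map_one' := by simp [Mp3.one_def]
  map_mul' x y := by
    rw [← ofAdd_add, Mp3.mul_def]; simp [red_act]

/-- second coordinate -/
def sndHom : Mp3 p →* Multiplicative (ZMod p) where
  toFun x := Multiplicative.ofAdd x.snd
  map_one' := by simp [Mp3.one_def]
  map_mul' x y := by rw [← ofAdd_add, Mp3.mul_def]

lemma fst_mul (x y : Mp3 p) : red p (x * y).fst = red p x.fst + red p y.fst :=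
  congrArg Multiplicative.toAdd ((fstHom p).map_mul x y)

lemma fst_inv (x : Mp3 p) : red p (x⁻¹).fst = - red p x.fst :=
  congrArg Multiplicative.toAdd ((fstHom p).map_inv x)

lemma fst_pow (x : Mp3 p) (n : ℕ) : red p (x ^ n).fst = n * red p x.fst := by
  have := congrArg Multiplicative.toAdd ((fstHom p).map_pow x n)
  rw [toAdd_pow, nsmul_eq_mul] at this
  exact this

lemma snd_mul (x y : Mp3 p) : (x * y).snd = x.snd + y.snd := rfl

lemma snd_inv (x : Mp3 p) : (x⁻¹).snd = - x.snd := rfl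

lemma snd_pow (x : Mp3 p) (n : ℕ) : (x ^ n).snd = n * x.snd := by
  have := congrArg Multiplicative.toAdd ((sndHom p).map_pow x n)
  rw [toAdd_pow, nsmul_eq_mul] at this
  exact this

lemma pow_of_snd (u : ZMod (p ^ 2)) (n : ℕ) : (⟨u, 0⟩ : Mp3 p) ^ n = ⟨n * u, 0⟩ := by
  induction n with
  | zero => simp [Mp3.one_def]
  | succ n ih =>
    rw [pow_succ, ih, Mp3.mul_def]
    simp [Mp3.act_zero]; ring

lemma grp {G : Type*} [Group G] (Φ : G →* Mp3 p)
    (hs : ∃ g, red p (Φ g).fst = 1) :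
    Function.Surjective Φ ∨
      ∃ k : ZMod (p ^ 2), ∀ g, Mp3.act p (Φ g).snd = 1 + (p : ZMod (p ^ 2)) * k * (Φ g).fst := by
  have hp : p ≠ 0 := (Fact.out : p.Prime).ne_zero
  have : NeZero (p ^ 2) := ⟨pow_ne_zero _ hp⟩
  obtain ⟨g0, h0⟩ := hs
  by_cases hh : ∃ h, red p (Φ h).fst = 0 ∧ (Φ h).snd ≠ 0
  · left
    obtain ⟨h, ha, hb⟩ := hh
    have hpow : ∀ j : ZMod p, ∃ n : ℕ, (Φ (h ^ n)).snd = j := by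
      intro j
      refine ⟨(j / (Φ h).snd).val, ?_⟩
      rw [map_pow, snd_pow, ZMod.natCast_zmod_val]
      field_simp
    obtain ⟨m, hm⟩ := hpow (-(Φ g0).snd)
    have hfst : red p (Φ (g0 * h ^ m)).fst = 1 := by
      rw [map_mul, fst_mul, map_pow, fst_pow, h0, ha]; simp
    have hsnd : (Φ (g0 * h ^ m)).snd = 0 := by
      rw [map_mul, snd_mul, hm]; simp
    obtain ⟨w, hw⟩ := red_unit p _ hfst
    have hall : ∀ i : ZMod (p ^ 2), ∃ g, Φ g = ⟨i, 0⟩ := by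
      intro i
      refine ⟨(g0 * h ^ m) ^ (i * w).val, ?_⟩
      rw [map_pow]
      have : Φ (g0 * h ^ m) = ⟨(Φ (g0 * h ^ m)).fst, 0⟩ := by rw [← hsnd]
      rw [this, pow_of_snd, ZMod.natCast_zmod_val, mul_assoc, hw, mul_one]
    rintro ⟨i, j⟩
    obtain ⟨n, hn⟩ := hpow j
    obtain ⟨g, hg⟩ := hall (i - (Φ (h ^ n)).fst)
    refine ⟨g * h ^ n, ?_⟩
    rw [map_mul, hg, Mp3.mul_def]
    simp only [Mp3.act_zero, hn]
    simp
  · right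
    push Not at hh
    refine ⟨((Φ g0).snd.val : ℕ), fun g => ?_⟩
    have h1 := hh (g * (g0 ^ (Φ g).fst.val)⁻¹) (by
      rw [map_mul, fst_mul, map_inv, fst_inv, map_pow, fst_pow, h0, mul_one,
        ← map_natCast (red p), ZMod.natCast_zmod_val, add_neg_cancel])
    rw [map_mul, snd_mul, map_inv, snd_inv, map_pow, snd_pow, add_neg_eq_zero] at h1
    rw [h1]
    have h2 : (((Φ g).fst.val : ℕ) : ZMod p) * (Φ g0).snd =
        (((Φ g0).snd.val * (Φ g).fst.val : ℕ) : ZMod p) := by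
      push_cast
      rw [ZMod.natCast_zmod_val (Φ g0).snd, mul_comm]
    rw [h2, act_natCast]
    push_cast
    rw [ZMod.natCast_zmod_val (Φ g).fst]
    ring

lemma grp2 (hodd : p ≠ 2) {G : Type*} [Group G] (Φ : G →* Mp3 p)
    (k : ZMod (p ^ 2)) (hk : ∀ g, Mp3.act p (Φ g).snd = 1 + (p : ZMod (p ^ 2)) * k * (Φ g).fst) :
    ∃ Ψ : G →* Multiplicative (ZMod (p ^ 2)), (∀ g, Φ g = 1 → Ψ g = 1) ∧
      ∀ g, red p (Ψ g).toAdd = red p (Φ g).fst := by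
  have h2 : ((2 : ℕ) : ZMod (p ^ 2)) * ((2 : ℕ) : ZMod (p ^ 2))⁻¹ = 1 := by
    apply ZMod.coe_mul_inv_eq_one
    apply Nat.Coprime.pow_right
    exact ((Nat.coprime_primes Nat.prime_two Fact.out).2 hodd.symm)
  push_cast at h2
  set c := (2 : ZMod (p ^ 2))⁻¹
  refine ⟨⟨⟨fun g => Multiplicative.ofAdd
    ((Φ g).fst - p * k * c * (Φ g).fst ^ 2), ?_⟩, ?_⟩, ?_, ?_⟩
  · simp [Mp3.one_def]
  · intro g h
    simp only
    rw [← ofAdd_add, map_mul, Mp3.mul_def]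
    simp only
    rw [hk g]
    congr 1
    generalize (Φ g).fst = x
    generalize (Φ h).fst = y
    have := psq p
    generalize (p : ZMod (p ^ 2)) = q at *
    linear_combination (-q * k * x * y) * h2 +
      (- k ^ 2 * c * (2 * (x + y) * x * y + q * k * x ^ 2 * y ^ 2)) * this
  · intro g hg
    simp [hg, Mp3.one_def]
  · intro g
    simp

lemma surj_of_red {G : Type*} [Group G] (Ψ : G →* Multiplicative (ZMod (p ^ 2)))
    (hs : ∃ g, red p (Ψ g).toAdd = 1) : Function.Surjective Ψ := by
  have hp : p ≠ 0 := (Fact.out : p.Prime).ne_zero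
  have : NeZero (p ^ 2) := ⟨pow_ne_zero _ hp⟩
  obtain ⟨g, hg⟩ := hs
  obtain ⟨w, hw⟩ := red_unit p _ hg
  intro i
  refine ⟨g ^ (i.toAdd * w).val, ?_⟩
  apply Multiplicative.toAdd.injective
  rw [map_pow, toAdd_pow, nsmul_eq_mul, ZMod.natCast_zmod_val, mul_assoc, hw, mul_one]

lemma prim_pow {K : Type*} [Field K] {z : K} {k : ℕ} (hz : IsPrimitiveRoot z k) (h0 : z ≠ 0)
    {a b : ℕ} (h : z ^ a = z ^ b) : (a : ZMod k) = b := by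
  wlog hab : a ≤ b generalizing a b
  · exact (this h.symm (le_of_not_ge hab)).symm
  obtain ⟨c, rfl⟩ := Nat.exists_eq_add_of_le hab
  have h1 : z ^ c = 1 := by
    apply mul_left_cancel₀ (pow_ne_zero a h0)
    rw [← pow_add, ← h, mul_one]
  have h2 := hz.dvd_of_pow_eq_one _ h1
  rw [← ZMod.natCast_eq_zero_iff] at h2
  rw [Nat.cast_add, h2, add_zero]

lemma cont_of_ker {F : Type*} [Field F] {M : Type*} [Group M] [TopologicalSpace M]
    [DiscreteTopology M] (Φ : Gal F →* M) (S : Finset (AlgebraicClosure F))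
    (h : ∀ g : Gal F, (∀ x ∈ S, g x = x) → Φ g = 1) : Continuous Φ := by
  apply continuous_of_continuousAt_one
  rw [ContinuousAt, map_one, nhds_discrete M, Filter.tendsto_pure]
  rw [Filter.Eventually, krullTopology_mem_nhds_one_iff]
  refine ⟨IntermediateField.adjoin F (S : Set (AlgebraicClosure F)), ?_, ?_⟩
  · apply IntermediateField.finiteDimensional_adjoin
    intro x _
    exact Algebra.IsIntegral.isIntegral x
  · intro g hg
    apply h
    intro x hx
    rw [SetLike.mem_coe, IntermediateField.mem_fixingSubgroup_iff] at hg
    exact hg x (IntermediateField.subset_adjoin _ _ hx)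

lemma kummer {F : Type*} [Field F] (ζ : F) (hζ : ζ ^ p = 1)
    (ψ : Gal F →* Multiplicative (ZMod p)) (hc : Continuous ψ) :
    ∃ α : AlgebraicClosure F, α ≠ 0 ∧ ∀ g : Gal F,
      g α = (algebraMap F (AlgebraicClosure F) ζ) ^ (ψ g).toAdd.val * α := by
  have hp : p ≠ 0 := (Fact.out : p.Prime).ne_zero
  have h1 : ψ ⁻¹' {1} ∈ nhds (1 : Gal F) := by
    apply hc.continuousAt
    rw [map_one]
    exact (isOpen_discrete ({1} : Set (Multiplicative (ZMod p)))).mem_nhds rfl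
  rw [krullTopology_mem_nhds_one_iff_of_normal] at h1
  obtain ⟨E, hfin, hnor, hE⟩ := h1
  have hsurj := AlgEquiv.restrictNormalHom_surjective (F := F) (K₁ := E) (AlgebraicClosure F)
  let r : Gal F →* (E ≃ₐ[F] E) := AlgEquiv.restrictNormalHom E
  have hker : r.ker ≤ ψ.ker := by
    intro g hg
    have : g ∈ E.fixingSubgroup := by
      rw [← IntermediateField.restrictNormalHom_ker]; exact hg
    exact hE this
  choose l hl using hsurj
  have hψl : ∀ g, ψ (l (r g)) = ψ g := by
    intro g
    have : l (r g) * g⁻¹ ∈ ψ.ker := by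
      apply hker
      rw [MonoidHom.mem_ker, map_mul, map_inv, mul_inv_eq_one]
      exact hl _
    rwa [MonoidHom.mem_ker, map_mul, map_inv, mul_inv_eq_one] at this
  have hζ0 : ζ ≠ 0 := by rintro rfl; simp [hp] at hζ
  let z : Eˣ := Units.mk0 (algebraMap F E ζ) (by simpa using hζ0)
  have hzp : z ^ p = 1 := by
    ext1; simp [z, ← map_pow, hζ]
  have hcoc : groupCohomology.IsMulCocycle₁ (fun s : E ≃ₐ[F] E => z ^ (ψ (l s)).toAdd.val) := by
    intro s t
    have e1 : ψ (l (s * t)) = ψ (l s) * ψ (l t) := by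
      rw [← map_mul, ← hψl (l s * l t), map_mul]
      congr 2
      rw [show r (l s) = s from hl s, show r (l t) = t from hl t]
    have e2 : s • z ^ (ψ (l t)).toAdd.val = z ^ (ψ (l t)).toAdd.val := by
      ext1
      simp [z]
    simp only
    rw [e2, e1, toAdd_mul, ZMod.val_add, ← pow_add, add_comm]
    exact (pow_eq_pow_mod _ hzp).symm
  obtain ⟨x, hx⟩ := groupCohomology.isMulCoboundary₁_of_isMulCocycle₁_of_aut_to_units _ hcoc
  refine ⟨((x : E) : AlgebraicClosure F), by simp, fun g => ?_⟩
  have h2 := hx (r g)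
  simp only [hψl] at h2
  rw [div_eq_iff_eq_mul] at h2
  have h3 := congrArg (fun u : Eˣ => ((u : E) : AlgebraicClosure F)) h2
  have h4 : (((r g) (x : E) : E) : AlgebraicClosure F) = g ((x : E) : AlgebraicClosure F) :=
    AlgEquiv.restrictNormal_commutes g E (x : E)
  rw [← h4]
  simpa [z] using h3

lemma toMp3 {F : Type*} [Field F] (ζ : F) (hζ : IsPrimitiveRoot ζ p)
    (ψ : Gal F →* Multiplicative (ZMod p)) (hc : Continuous ψ) :
    ∃ (Φ : Gal F →* Mp3 p) (S : Finset (AlgebraicClosure F)),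
      (∀ g : Gal F, (∀ x ∈ S, g x = x) → Φ g = 1) ∧
      ∀ g, red p (Φ g).fst = (ψ g).toAdd := by
  have hpp : p.Prime := Fact.out
  have hp : p ≠ 0 := hpp.ne_zero
  have : NeZero (p ^ 2) := ⟨pow_ne_zero _ hp⟩
  obtain ⟨α, hα0, hα⟩ := kummer p ζ hζ.pow_eq_one ψ hc
  set Z := algebraMap F (AlgebraicClosure F) ζ with hZ
  have hZp : IsPrimitiveRoot Z p := hζ.map_of_injective (algebraMap F _).injective
  obtain ⟨ξ, hξ⟩ := IsAlgClosed.exists_pow_nat_eq Z hpp.pos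
  obtain ⟨β, hβ⟩ := IsAlgClosed.exists_pow_nat_eq α hpp.pos
  have hβ0 : β ≠ 0 := by rintro rfl; simp [hp] at hβ; exact hα0 hβ.symm
  have hξp : IsPrimitiveRoot ξ (p ^ 2) := by
    have : orderOf ξ = p ^ (1 + 1) := by
      apply orderOf_eq_prime_pow
      · rw [pow_one, hξ]; exact hZp.ne_one hpp.one_lt
      · rw [pow_add, pow_mul, pow_one, hξ, hZp.pow_eq_one]
    rw [← show orderOf ξ = p ^ 2 from this]
    exact IsPrimitiveRoot.orderOf ξ
  have hξ0 : ξ ≠ 0 := hξp.ne_zero (NeZero.ne _)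
  have hm : ∀ g : Gal F, ∃ m : ℕ, g ξ = ξ ^ (1 + p * m) := by
    intro g
    have : (g ξ / ξ) ^ p = 1 := by
      rw [div_pow, ← map_pow, hξ, hZ, AlgEquiv.commutes, ← hZ, div_self]
      exact hZp.ne_zero hp
    obtain ⟨m, -, hm⟩ := hZp.eq_pow_of_pow_eq_one this
    refine ⟨m, ?_⟩
    rw [pow_add, pow_mul, hξ, hm, pow_one]; field_simp
  have hn : ∀ g : Gal F, ∃ n : ℕ, g β = ξ ^ n * β := by
    intro g
    have : (g β / β) ^ (p ^ 2) = 1 := by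
      rw [sq, pow_mul, div_pow, ← map_pow, hβ, hα, mul_div_assoc, div_self hα0, mul_one,
        pow_right_comm, hZp.pow_eq_one, one_pow]
    obtain ⟨n, -, hn⟩ := hξp.eq_pow_of_pow_eq_one this
    refine ⟨n, ?_⟩
    rw [hn]; field_simp
  choose m hm using hm
  choose n hn using hn
  have hmod : ∀ a b : ℕ, ξ ^ a = ξ ^ b → (a : ZMod (p ^ 2)) = b :=
    fun a b h => prim_pow hξp hξ0 h
  have hn1 : ∀ g h, ((n (g * h) : ℕ) : ZMod (p ^ 2)) = n g + (1 + p * m g) * n h := by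
    intro g h
    have : ξ ^ n (g * h) * β = ξ ^ (n g + (1 + p * m g) * n h) * β := by
      rw [← hn, AlgEquiv.mul_apply, hn h, map_mul, map_pow, hm, hn g, pow_add, pow_mul]
      ring
    have := hmod _ _ (mul_right_cancel₀ hβ0 this)
    rw [this]; push_cast; rfl
  have hm1 : ∀ g h, ((m (g * h) : ℕ) : ZMod p) = m g + m h := by
    intro g h
    have h1 : ξ ^ (1 + p * m (g * h)) = ξ ^ ((1 + p * m g) * (1 + p * m h)) := by
      rw [← hm, AlgEquiv.mul_apply, hm h, map_pow, hm, pow_mul]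
    have h2 : Z ^ m (g * h) = Z ^ (m g + m h) := by
      have h3 : (1 + p * m g) * (1 + p * m h) = 1 + p * (m g + m h) + p ^ 2 * (m g * m h) := by
        ring
      rw [h3, pow_add _ _ (p ^ 2 * _), pow_mul _ (p ^ 2), hξp.pow_eq_one, one_pow, mul_one,
        pow_add, pow_add _ 1, pow_one, pow_mul, pow_mul, hξ] at h1
      exact mul_left_cancel₀ hξ0 h1
    exact_mod_cast prim_pow hZp (hZp.ne_zero hp) h2
  have hψ : ∀ g, ((n g : ℕ) : ZMod p) = (ψ g).toAdd := by
    intro g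
    have h2 : Z ^ n g = Z ^ (ψ g).toAdd.val := by
      apply mul_right_cancel₀ hα0
      rw [← hα, ← hβ, map_pow, hn, mul_pow, pow_right_comm, hξ]
    rw [prim_pow hZp (hZp.ne_zero hp) h2, ZMod.natCast_zmod_val]
  let Φ : Gal F →* Mp3 p := MonoidHom.mk' (fun g => ⟨n g, m g⟩) (by
    intro g h
    rw [Mp3.mul_def]
    simp only [act_natCast, hn1, hm1])
  classical
  refine ⟨Φ, {ξ, β}, ?_, ?_⟩
  · intro g hg
    have h1 := hg ξ (by simp)
    have h2 := hg β (by simp)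
    have h3 : ((n g : ℕ) : ZMod (p ^ 2)) = (0 : ℕ) := by
      apply hmod _ _
      apply mul_right_cancel₀ hβ0
      rw [← hn, h2]; simp
    have h4 : ((m g : ℕ) : ZMod p) = 0 := by
      rw [hm, pow_add, pow_one, pow_mul, hξ] at h1
      have h5 : Z ^ m g = 1 := by
        apply mul_left_cancel₀ hξ0
        rw [h1, mul_one]
      rw [ZMod.natCast_eq_zero_iff]
      exact hZp.dvd_of_pow_eq_one _ h5
    change (⟨n g, m g⟩ : Mp3 p) = ⟨0, 0⟩
    rw [h3, h4, Nat.cast_zero]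
  · intro g
    change red p ((n g : ℕ) : ZMod (p ^ 2)) = _
    rw [map_natCast, hψ]

end Mp3Aux

/-- Let `p` be an odd prime and `F` a field of characteristic `≠ p` containing a primitive
`p`-th root of unity, with absolute Galois group `G = G_F`.  Every continuous surjective
homomorphism `ψ : G → ℤ/p` factors either through the reduction `ℤ/p² → ℤ/p`, or through
the homomorphism `λ'' : M_{p³} → ℤ/p`, `(i, j) ↦ i mod p`, via continuous surjective
homomorphisms `Φ`. -/
theorem surjection_to_ZmodP_factors (p : ℕ) [Fact p.Prime] (hodd : p ≠ 2)
    (F : Type*) [Field F] (hchar : ringChar F ≠ p) (hroot : ∃ ζ : F, IsPrimitiveRoot ζ p)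
    (ψ : Gal F →* Multiplicative (ZMod p)) (hc : Continuous ψ)
    (hs : Function.Surjective ψ) :
    (∃ Φ : Gal F →* Multiplicative (ZMod (p ^ 2)), Continuous Φ ∧ Function.Surjective Φ ∧
      ∀ g : Gal F, ψ g = Multiplicative.ofAdd
        (ZMod.castHom (dvd_pow_self p (by norm_num : (2 : ℕ) ≠ 0)) (ZMod p)
          (Multiplicative.toAdd (Φ g)))) ∨
    (∃ Φ : Gal F →* Mp3 p, Continuous Φ ∧ Function.Surjective Φ ∧
      ∀ g : Gal F, ψ g = Multiplicative.ofAdd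
        (ZMod.castHom (dvd_pow_self p (by norm_num : (2 : ℕ) ≠ 0)) (ZMod p) ((Φ g).fst))) := by
  obtain ⟨ζ, hζ⟩ := hroot
  obtain ⟨Φ, S, hS, hΦ⟩ := Mp3Aux.toMp3 p ζ hζ ψ hc
  obtain ⟨g0, hg0⟩ := hs (Multiplicative.ofAdd 1)
  have h0 : Mp3Aux.red p (Φ g0).fst = 1 := by rw [hΦ, hg0]; rfl
  rcases Mp3Aux.grp p Φ ⟨g0, h0⟩ with h | ⟨k, hk⟩
  · right
    have : DiscreteTopology (Mp3 p) := ⟨rfl⟩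
    refine ⟨Φ, Mp3Aux.cont_of_ker Φ S hS, h, fun g => ?_⟩
    exact congrArg Multiplicative.ofAdd (hΦ g).symm
  · left
    obtain ⟨Ψ, hΨ1, hΨ⟩ := Mp3Aux.grp2 p hodd Φ k hk
    have : DiscreteTopology (ZMod (p ^ 2)) := ⟨rfl⟩
    refine ⟨Ψ, Mp3Aux.cont_of_ker Ψ S (fun g hg => hΨ1 g (hS g hg)),
      Mp3Aux.surj_of_red p Ψ ⟨g0, by rw [hΨ, h0]⟩, fun g => ?_⟩
    exact congrArg Multiplicative.ofAdd ((hΨ g).trans (hΦ g)).symm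
end

section
/- Let F be a field of characteristic different from 2 which is not Euclidean, with absolute Galois group G = G_F. Then every continuous surjective group homomorphism ψ : G → ℤ/2 factors in one of the following three ways: (i) there exists a continuous surjective homomorphism Φ : G → ℤ/4 with ψ = π ∘ Φ, where π : ℤ/4 → ℤ/2 is the reduction homomorphism; (ii) there exists a continuous surjective homomorphism Φ : G → D₄ with ψ = θ' ∘ Φ, where θ' : D₄ → ℤ/2 is the homomorphism determined by θ'(r) = 1, θ'(s) = 0; or (iii) there exists a continuous surjective homomorphism Φ : G → D₄ with ψ = θ'' ∘ Φ, where θ'' : D₄ → ℤ/2 is the homomorphism determined by θ''(r) = 0, θ''(s) = 1. -/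
instance (n : ℕ) : TopologicalSpace (DihedralGroup n) := ⊥

/-- The homomorphism `θ' : D₄ → ℤ/2` determined by `θ'(r) = 1`, `θ'(s) = 0`
(so `θ'(r^i s^j) = i mod 2`). -/
def theta' : DihedralGroup 4 → ZMod 2
  | DihedralGroup.r i => ZMod.castHom (show (2:ℕ) ∣ 4 by norm_num) (ZMod 2) i
  | DihedralGroup.sr i => ZMod.castHom (show (2:ℕ) ∣ 4 by norm_num) (ZMod 2) i

/-- The homomorphism `θ'' : D₄ → ℤ/2` determined by `θ''(r) = 0`, `θ''(s) = 1`
(so `θ''(r^i s^j) = j mod 2`). -/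
def theta'' : DihedralGroup 4 → ZMod 2
  | DihedralGroup.r _ => 0
  | DihedralGroup.sr _ => 1

/-- A field is Euclidean if `-1` is not a square and every element is a square or the
negative of a square. -/
def IsEuclideanField (F : Type*) [Field F] : Prop :=
  (¬ ∃ x : F, x ^ 2 = -1) ∧ ∀ a : F, (∃ x : F, x ^ 2 = a) ∨ (∃ x : F, x ^ 2 = -a)

def zsgn (z : Multiplicative (ZMod 2)) : ℤ := if z = 1 then 1 else -1

theorem zsgn_mul : ∀ a b, zsgn (a * b) = zsgn a * zsgn b := by
  unfold zsgn; decide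

theorem zsgn_sq : ∀ a, zsgn a * zsgn a = 1 := by
  unfold zsgn; decide

theorem exists_neg {F : Type*} [Field F] {x : AlgebraicClosure F} {c : F}
    (hx : x ^ 2 = algebraMap F _ c) (hc : ∀ b : F, b ^ 2 ≠ c) :
    ∃ g : Gal F, g x = -x := by
  have hirr := X_pow_sub_C_irreducible_of_prime Nat.prime_two hc
  have hmon : (Polynomial.X ^ 2 - Polynomial.C c : Polynomial F).Monic :=
    Polynomial.monic_X_pow_sub_C c (by norm_num)
  have hmin : (Polynomial.X ^ 2 - Polynomial.C c : Polynomial F) = minpoly F (-x) :=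
    minpoly.eq_of_irreducible_of_monic hirr (by simp [hx]) hmon
  refine minpoly.exists_algEquiv_of_root (Algebra.IsAlgebraic.isAlgebraic _) ?_
  rw [← hmin]; simp [hx]

theorem fixed_pow_mem {F : Type*} [Field F] (q : ℕ) [ExpChar F q] {x : AlgebraicClosure F}
    (hx : ∀ g : Gal F, g x = x) : ∃ n, x ^ q ^ n ∈ (algebraMap F (AlgebraicClosure F)).range := by
  classical
  rw [← minpoly.natSepDegree_eq_one_iff_pow_mem q,
    Polynomial.natSepDegree_eq_of_isAlgClosed (AlgebraicClosure F), Finset.card_eq_one]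
  have hint : IsIntegral F x := (Algebra.IsAlgebraic.isAlgebraic x).isIntegral
  refine ⟨x, ?_⟩
  ext y
  rw [Multiset.mem_toFinset, Polynomial.mem_aroots, Finset.mem_singleton]
  constructor
  · rintro ⟨-, hy⟩
    obtain ⟨σ, hσ⟩ := minpoly.exists_algEquiv_of_root (Algebra.IsAlgebraic.isAlgebraic x) hy
    have := hx σ⁻¹
    rw [← hσ] at this
    rw [← hσ, ← this]
    simp [AlgEquiv.aut_inv] at *
  · rintro rfl
    exact ⟨minpoly.ne_zero hint, minpoly.aeval _ _⟩

theorem kummer_zero {F : Type*} [Field F]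
    (ψ : Gal F →* Multiplicative (ZMod 2)) (hc : Continuous ψ) :
    ∃ δ : AlgebraicClosure F, δ ≠ 0 ∧ ∀ g : Gal F, g δ = (zsgn (ψ g) : AlgebraicClosure F) * δ := by
  classical
  have hk : (ψ ⁻¹' {1}) ∈ nhds (1 : Gal F) := by
    apply hc.continuousAt.preimage_mem_nhds
    rw [map_one]
    exact (isOpen_discrete (α := Multiplicative (ZMod 2)) _).mem_nhds rfl
  rw [krullTopology_mem_nhds_one_iff_of_normal] at hk
  obtain ⟨E, hE, hN, hs⟩ := hk
  let ρ : Gal F →* (E ≃ₐ[F] E) := AlgEquiv.restrictNormalHom E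
  have hρ : Function.Surjective ρ := AlgEquiv.restrictNormalHom_surjective _
  have hρc : ∀ (g : Gal F) (x : E), ((ρ g x : E) : AlgebraicClosure F) = g x := fun g x =>
    AlgEquiv.restrictNormal_commutes g E x
  have hker : ∀ g h : Gal F, ρ g = ρ h → ψ g = ψ h := by
    intro g h hgh
    have h1 : ρ (g⁻¹ * h) = 1 := by rw [map_mul, map_inv, hgh, inv_mul_cancel]
    have h2 : g⁻¹ * h ∈ (E.fixingSubgroup : Set (Gal F)) := by
      rw [SetLike.mem_coe, IntermediateField.mem_fixingSubgroup_iff]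
      intro x hx
      have := hρc (g⁻¹ * h) ⟨x, hx⟩
      rw [h1] at this
      exact this.symm
    have h3 : ψ (g⁻¹ * h) = 1 := hs h2
    rw [map_mul, map_inv] at h3
    exact (inv_mul_eq_one.mp h3)
  choose l hl using hρ
  let c : (E ≃ₐ[F] E) → E := fun σ => ((zsgn (ψ (l σ)) : ℤ) : E)
  have hli := (linearIndependent_monoidHom E E).comp
    (fun σ : (E ≃ₐ[F] E) => ((σ : E →+* E) : E →* E)) (by
      intro σ τ h
      ext x
      have := DFunLike.congr_fun h x
      simpa using this)
  have hne : ∃ x : E, ∑ σ, c σ * σ x ≠ 0 := by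
    by_contra! hcon
    have := Fintype.linearIndependent_iff.mp hli c (by
      funext x
      have := hcon x
      simpa [Finset.sum_apply] using this) 1
    have h2 := congrArg (fun z : E => z * z) this
    simp only [c, ← Int.cast_mul, zsgn_sq] at h2
    simp at h2
  obtain ⟨x, hx⟩ := hne
  refine ⟨((∑ σ, c σ * σ x : E) : AlgebraicClosure F), fun h => hx (Subtype.ext h), fun g => ?_⟩
  rw [← hρc]
  have key : ρ g (∑ σ, c σ * σ x) = ((zsgn (ψ g) : ℤ) : E) * ∑ σ, c σ * σ x := by
    rw [map_sum, Finset.mul_sum]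
    refine Fintype.sum_equiv (Equiv.mulLeft (ρ g)) _ _ fun σ => ?_
    have e : ψ (l (ρ g * σ)) = ψ g * ψ (l σ) := by
      rw [← map_mul]; apply hker; rw [hl, map_mul, hl]
    simp only [Equiv.coe_mulLeft, c, e, zsgn_mul, map_mul, map_intCast, Int.cast_mul,
      AlgEquiv.mul_apply]
    rw [← mul_assoc, ← mul_assoc, ← Int.cast_mul, zsgn_sq]; simp
  rw [key]; simp

theorem kummer {F : Type*} [Field F] (hchar : ringChar F ≠ 2)
    (ψ : Gal F →* Multiplicative (ZMod 2)) (hc : Continuous ψ) :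
    ∃ (δ : AlgebraicClosure F) (d : F), δ ≠ 0 ∧ δ ^ 2 = algebraMap F _ d ∧
      ∀ g : Gal F, g δ = (zsgn (ψ g) : AlgebraicClosure F) * δ := by
  obtain ⟨δ, h0, hδ⟩ := kummer_zero ψ hc
  obtain ⟨q, hq⟩ := ExpChar.exists F
  have hodd : Odd q := by
    rcases hq with _ | hp
    · exact odd_one
    · refine hp.odd_of_ne_two ?_
      rintro rfl
      exact hchar (ringChar.eq F 2)
  obtain ⟨n, d, hd⟩ := fixed_pow_mem (F := F) q (x := δ ^ 2) (by
    intro g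
    rw [map_pow, hδ, mul_pow, sq ((zsgn (ψ g) : ℤ) : AlgebraicClosure F), ← Int.cast_mul, zsgn_sq]
    simp)
  refine ⟨δ ^ q ^ n, d, pow_ne_zero _ h0, ?_, fun g => ?_⟩
  · rw [hd, ← pow_mul, ← pow_mul, mul_comm]
  · rw [map_pow, hδ, mul_pow]
    congr 1
    unfold zsgn
    split_ifs
    · simp
    · push_cast
      exact (hodd.pow).neg_one_pow

section roots
variable {L : Type*} [Field L]

def e4 (i : L) (k : ZMod 4) : L := i ^ k.val

theorem e4_add {i : L} (hi : i ^ 2 = -1) (k l : ZMod 4) : e4 i (k + l) = e4 i k * e4 i l := by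
  have h4 : i ^ 4 = 1 := by rw [show 4 = 2 * 2 from rfl, pow_mul, hi]; norm_num
  unfold e4
  rw [ZMod.val_add, ← pow_add]
  conv_rhs => rw [← Nat.div_add_mod (k.val + l.val) 4, pow_add, pow_mul, h4, one_pow, one_mul]

theorem e4_neg (i : L) (hi : i ^ 2 = -1) (k : ZMod 4) : e4 (-i) k = e4 i (-k) := by
  fin_cases k
  · change (-i) ^ 0 = i ^ 0
    simp
  · change (-i) ^ 1 = i ^ 3
    linear_combination i * (-hi)
  · change (-i) ^ 2 = i ^ 2
    ring
  · change (-i) ^ 3 = i ^ 1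
    linear_combination i * (-hi)

theorem e4_inj {i : L} (hi : i ^ 2 = -1) (h2 : (2 : L) ≠ 0) {k l : ZMod 4}
    (h : e4 i k = e4 i l) : k = l := by
  have h4 : i ^ 4 = 1 := by linear_combination (i ^ 2 - 1) * hi
  have h1 : e4 i (k - l) = 1 := by
    have h' : e4 i l ≠ 0 := by
      unfold e4; apply pow_ne_zero; rintro rfl; simp at hi
    apply mul_right_cancel₀ h'
    rw [← e4_add hi, sub_add_cancel, h, one_mul]
  rw [← sub_eq_zero]
  generalize k - l = m at h1
  fin_cases m
  · rfl
  · exfalso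
    change i ^ 1 = 1 at h1
    apply h2
    linear_combination hi - (i + 1) * h1
  · exfalso
    change i ^ 2 = 1 at h1
    apply h2
    linear_combination hi - h1
  · exfalso
    change i ^ 3 = 1 at h1
    apply h2
    linear_combination (1+i^4 - i ^ 2) * hi - (i ^ 3 + 1) * h1

theorem e4_sq {i : L} (hi : i ^ 2 = -1) (h2 : (2 : L) ≠ 0) (k : ZMod 4) :
    (e4 i k ^ 2 = 1 ∧ ZMod.castHom (show (2:ℕ) ∣ 4 by norm_num) (ZMod 2) k = 0) ∨
    (e4 i k ^ 2 = -1 ∧ ZMod.castHom (show (2:ℕ) ∣ 4 by norm_num) (ZMod 2) k = 1) := by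
  fin_cases k
  · left; exact ⟨by change (i ^ 0) ^ 2 = 1; simp, rfl⟩
  · right; exact ⟨by change (i ^ 1) ^ 2 = -1; simp [hi], rfl⟩
  · left; exact ⟨by change (i ^ 2) ^ 2 = 1; simp [hi], rfl⟩
  · right; exact ⟨by change (i ^ 3) ^ 2 = -1; linear_combination (i ^ 4 - i ^ 2 + 1) * hi, rfl⟩

theorem e4_exists {i : L} (hi : i ^ 2 = -1) {α β : L} (hα : α ≠ 0) (h : β ^ 4 = α ^ 4) :
    ∃ k, β = e4 i k * α := by
  have : (β - α) * (β + α) * ((β - i * α) * (β + i * α)) = 0 := by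
    linear_combination h - (β ^ 2 - α ^ 2) * α ^ 2 * hi
  rcases mul_eq_zero.mp this with h | h <;> rcases mul_eq_zero.mp h with h | h
  · exact ⟨0, by change β = i ^ 0 * α; linear_combination h⟩
  · exact ⟨2, by change β = i ^ 2 * α; linear_combination h - α * hi⟩
  · exact ⟨1, by change β = i ^ 1 * α; linear_combination h⟩
  · exact ⟨3, by change β = i ^ 3 * α; linear_combination h - i * α * hi⟩

end roots

theorem cont_of_stab {F : Type*} [Field F] {M : Type*} [Group M] [TopologicalSpace M]
    [DiscreteTopology M] (Φ : Gal F →* M) (x y : AlgebraicClosure F)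
    (h : ∀ g : Gal F, g x = x → g y = y → Φ g = 1) : Continuous Φ := by
  apply continuous_of_continuousAt_one
  unfold ContinuousAt
  rw [map_one, nhds_discrete M, Filter.tendsto_pure]
  have hx := (stabilizer_isOpen_of_isIntegral (K := F) x).mem_nhds (one_mem _)
  have hy := (stabilizer_isOpen_of_isIntegral (K := F) y).mem_nhds (one_mem _)
  filter_upwards [hx, hy] with g h1 h2
  exact h g h1 h2

instance discMul (n : ℕ) : DiscreteTopology (Multiplicative (ZMod n)) := ⟨rfl⟩
instance discDih (n : ℕ) : DiscreteTopology (DihedralGroup n) := ⟨rfl⟩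

open Classical in
theorem cyclic_case {F : Type*} [Field F] (h2 : (2 : AlgebraicClosure F) ≠ 0)
    {i α : AlgebraicClosure F} (hi : i ^ 2 = -1) {a : F} (hα0 : α ≠ 0)
    (hα : α ^ 4 = algebraMap F _ a) (hiF : ∀ g : Gal F, g i = i)
    (hex : ∃ g : Gal F, g (α ^ 2) = - α ^ 2) :
    ∃ Φ : Gal F →* Multiplicative (ZMod 4), Continuous Φ ∧ Function.Surjective Φ ∧
      ∀ g : Gal F, ZMod.castHom (by norm_num : (2 : ℕ) ∣ 4) (ZMod 2) (Multiplicative.toAdd (Φ g))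
        = if g (α ^ 2) = α ^ 2 then 0 else 1 := by
  have hk : ∀ g : Gal F, ∃ k, g α = e4 i k * α := fun g => e4_exists hi hα0 (by
    rw [← map_pow, hα, AlgEquiv.commutes])
  choose k hk using hk
  have hge : ∀ (g : Gal F) m, g (e4 i m) = e4 i m := fun g m => by
    unfold e4; rw [map_pow, hiF]
  have huniq : ∀ g m, g α = e4 i m * α → k g = m := fun g m h =>
    e4_inj hi h2 (mul_right_cancel₀ hα0 ((hk g).symm.trans h))
  let Φ : Gal F →* Multiplicative (ZMod 4) := MonoidHom.mk' (fun g => Multiplicative.ofAdd (k g)) (by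
    intro g h
    rw [← ofAdd_add]
    congr 1
    apply huniq
    rw [AlgEquiv.mul_apply, hk h, map_mul, hge, hk g, e4_add hi]
    ring)
  have hm : ∀ g : Gal F, ZMod.castHom (by norm_num : (2 : ℕ) ∣ 4) (ZMod 2) (k g)
        = if g (α ^ 2) = α ^ 2 then 0 else 1 := by
    intro g
    have hsq : g (α ^ 2) = e4 i (k g) ^ 2 * α ^ 2 := by rw [map_pow, hk, mul_pow]
    rcases e4_sq hi h2 (k g) with ⟨h, h'⟩ | ⟨h, h'⟩
    · rw [h', hsq, h, one_mul, if_pos rfl]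
    · rw [h', hsq, h, if_neg]
      intro h3
      apply h2
      have := pow_ne_zero 2 hα0
      apply mul_right_cancel₀ this
      linear_combination -h3
  refine ⟨Φ, cont_of_stab Φ α α ?_, ?_, hm⟩
  · intro g hg _
    change Multiplicative.ofAdd (k g) = 1
    rw [huniq g 0 (by rw [hg]; simp [e4])]; rfl
  · obtain ⟨g, hg⟩ := hex
    have h1 := hm g
    rw [if_neg (by
      rw [hg]; intro h3; apply h2; apply mul_right_cancel₀ (pow_ne_zero 2 hα0)
      linear_combination -h3)] at h1
    intro m
    have key : ∀ k m : ZMod 4, ZMod.castHom (by norm_num : (2 : ℕ) ∣ 4) (ZMod 2) k = 1 →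
      ∃ n : Fin 4, n.val • k = m := by decide
    obtain ⟨n, hn⟩ := key (k g) (Multiplicative.toAdd m) h1
    refine ⟨g ^ n.val, ?_⟩
    rw [map_pow]
    change Multiplicative.ofAdd (n.val • k g) = m
    rw [hn]; rfl

open Classical in
theorem dihedral_case {F : Type*} [Field F] (h2 : (2 : AlgebraicClosure F) ≠ 0)
    {i α : AlgebraicClosure F} (hi : i ^ 2 = -1) {a : F} (hα0 : α ≠ 0)
    (hα : α ^ 4 = algebraMap F _ a)
    (h1 : ∀ b : F, b ^ 2 ≠ -1) (ha : ∀ b : F, b ^ 2 ≠ a) (hna : ∀ b : F, b ^ 2 ≠ -a) :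
    ∃ Φ : Gal F →* DihedralGroup 4, Continuous Φ ∧ Function.Surjective Φ ∧
      ∀ g : Gal F, theta' (Φ g) = (if g (α ^ 2) = α ^ 2 then 0 else 1) ∧
        theta'' (Φ g) = (if g i = i then 0 else 1) := by
  classical
  have hi0 : i ≠ 0 := by rintro rfl; simp at hi
  have hneg : ∀ x : AlgebraicClosure F, x ≠ 0 → -x ≠ x := by
    intro x hx h3; apply h2; apply mul_right_cancel₀ hx; linear_combination -h3
  have hii : ∀ g : Gal F, g i = i ∨ g i = -i := fun g => by
    apply sq_eq_sq_iff_eq_or_eq_neg.mp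
    rw [← map_pow, hi]; simp
  have hk : ∀ g : Gal F, ∃ k, g α = e4 i k * α := fun g => e4_exists hi hα0 (by
    rw [← map_pow, hα, AlgEquiv.commutes])
  choose k hk using hk
  have hge : ∀ (g : Gal F) m, g i = i → g (e4 i m) = e4 i m := fun g m h => by
    unfold e4; rw [map_pow, h]
  have hge' : ∀ (g : Gal F) m, g i = -i → g (e4 i m) = e4 i (-m) := fun g m h => by
    rw [← e4_neg i hi]; unfold e4; rw [map_pow, h]
  have huniq : ∀ g m, g α = e4 i m * α → k g = m := fun g m h =>
    e4_inj hi h2 (mul_right_cancel₀ hα0 ((hk g).symm.trans h))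
  have hkm : ∀ g h, g i = i → k (g * h) = k g + k h := fun g h hg => by
    apply huniq
    rw [AlgEquiv.mul_apply, hk h, map_mul, hge _ _ hg, hk g, e4_add hi]
    ring
  have hkm' : ∀ g h, g i = -i → k (g * h) = k g - k h := fun g h hg => by
    apply huniq
    rw [AlgEquiv.mul_apply, hk h, map_mul, hge' _ _ hg, hk g, sub_eq_add_neg, e4_add hi]
    ring
  let f : Gal F → DihedralGroup 4 := fun g =>
    if g i = i then DihedralGroup.r (k g) else DihedralGroup.sr (- k g)
  have fp : ∀ g : Gal F, g i = i → f g = DihedralGroup.r (k g) := fun g h => if_pos h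
  have fn : ∀ g : Gal F, g i = -i → f g = DihedralGroup.sr (-k g) := fun g h =>
    if_neg (by rw [h]; exact hneg i hi0)
  let Φ : Gal F →* DihedralGroup 4 := MonoidHom.mk' f (by
    intro g h
    rcases hii g with hg | hg <;> rcases hii h with hh | hh
    · rw [fp _ hg, fp _ hh, fp _ (by rw [AlgEquiv.mul_apply, hh, hg]), hkm _ _ hg,
        DihedralGroup.r_mul_r]
    · rw [fp _ hg, fn _ hh, fn _ (by rw [AlgEquiv.mul_apply, hh, map_neg, hg]), hkm _ _ hg,
        DihedralGroup.r_mul_sr]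
      congr 1; ring
    · rw [fn _ hg, fp _ hh, fn _ (by rw [AlgEquiv.mul_apply, hh, hg]), hkm' _ _ hg,
        DihedralGroup.sr_mul_r]
      congr 1; ring
    · rw [fn _ hg, fn _ hh, fp _ (by rw [AlgEquiv.mul_apply, hh, map_neg, hg, neg_neg]),
        hkm' _ _ hg, DihedralGroup.sr_mul_sr]
      congr 1; ring)
  have hm : ∀ g : Gal F, ZMod.castHom (by norm_num : (2 : ℕ) ∣ 4) (ZMod 2) (k g)
        = if g (α ^ 2) = α ^ 2 then 0 else 1 := by
    intro g
    have hsq : g (α ^ 2) = e4 i (k g) ^ 2 * α ^ 2 := by rw [map_pow, hk, mul_pow]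
    rcases e4_sq hi h2 (k g) with ⟨h, h'⟩ | ⟨h, h'⟩
    · rw [h', hsq, h, one_mul, if_pos rfl]
    · rw [h', hsq, h, if_neg]
      rw [neg_one_mul]
      exact hneg _ (pow_ne_zero 2 hα0)
  refine ⟨Φ, cont_of_stab Φ i α ?_, ?_, ?_⟩
  · intro g hg hg'
    change f g = 1
    rw [fp _ hg, huniq g 0 (by rw [hg']; simp [e4])]; rfl
  · obtain ⟨g2, hg2⟩ := exists_neg (F := F) (x := i) (c := -1) (by simp [hi]) h1
    have hg : ∃ g : Gal F, g i = i ∧ g (α ^ 2) = -α ^ 2 := by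
      obtain ⟨g1, hg1⟩ := exists_neg (F := F) (x := α ^ 2) (c := a) (by rw [← hα]; ring) ha
      obtain ⟨g3, hg3⟩ := exists_neg (F := F) (x := i * α ^ 2) (c := -a)
        (by rw [map_neg, ← hα]; linear_combination α ^ 4 * hi) hna
      rw [map_mul] at hg3
      rcases hii g1 with h | h
      · exact ⟨g1, h, hg1⟩
      rcases hii g3 with h' | h'
      · refine ⟨g3, h', mul_left_cancel₀ hi0 ?_⟩
        rw [h'] at hg3
        rw [hg3]; ring
      · have h3 : g3 (α ^ 2) = α ^ 2 := by
          apply mul_left_cancel₀ hi0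
          rw [h'] at hg3
          linear_combination -hg3
        exact ⟨g1 * g3, by rw [AlgEquiv.mul_apply, h', map_neg, h, neg_neg],
          by rw [AlgEquiv.mul_apply, h3, hg1]⟩
    obtain ⟨g, hgi, hgα⟩ := hg
    have e1 := hm g
    rw [if_neg (by rw [hgα]; exact hneg _ (pow_ne_zero 2 hα0))] at e1
    have key : ∀ k m : ZMod 4, ZMod.castHom (by norm_num : (2 : ℕ) ∣ 4) (ZMod 2) k = 1 →
      ∃ n : Fin 4, k * (n.val : ZMod 4) = m := by decide
    have hr : ∀ m, ∃ x, Φ x = DihedralGroup.r m := by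
      intro m
      obtain ⟨n, hn⟩ := key (k g) m e1
      refine ⟨g ^ n.val, ?_⟩
      have : Φ g = DihedralGroup.r (k g) := fp g hgi
      rw [map_pow, this, DihedralGroup.r_pow, hn]
    rintro (m | m)
    · exact hr m
    · obtain ⟨x, hx⟩ := hr (m + k g2)
      refine ⟨g2 * x, ?_⟩
      have : Φ g2 = DihedralGroup.sr (-k g2) := fn g2 hg2
      rw [map_mul, hx, this, DihedralGroup.sr_mul_r]
      congr 1; ring
  · intro g
    change theta' (f g) = _ ∧ theta'' (f g) = _
    rcases hii g with h | h
    · rw [fp _ h]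
      exact ⟨hm g, by rw [if_pos h]; rfl⟩
    · rw [fn _ h, ← hm g, if_neg (by rw [h]; exact hneg i hi0)]
      refine ⟨?_, rfl⟩
      have : ∀ k : ZMod 4, theta' (DihedralGroup.sr (-k)) =
        ZMod.castHom (by norm_num : (2 : ℕ) ∣ 4) (ZMod 2) k := by decide
      exact this _

theorem psi_eq : ∀ z : Multiplicative (ZMod 2), z ≠ 1 → z = Multiplicative.ofAdd 1 := by
  decide

/-- Let `F` be a non-Euclidean field of characteristic `≠ 2`, with absolute Galois group
`G = G_F`.  Every continuous surjective homomorphism `ψ : G → ℤ/2` factors through the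
reduction `ℤ/4 → ℤ/2`, or through `θ' : D₄ → ℤ/2`, or through `θ'' : D₄ → ℤ/2`, via a
continuous surjective homomorphism `Φ`. -/
theorem surjection_to_Zmod2_factors (F : Type*) [Field F] (hchar : ringChar F ≠ 2)
    (heucl : ¬ IsEuclideanField F)
    (ψ : Gal F →* Multiplicative (ZMod 2)) (hc : Continuous ψ)
    (hs : Function.Surjective ψ) :
    (∃ Φ : Gal F →* Multiplicative (ZMod 4), Continuous Φ ∧ Function.Surjective Φ ∧
      ∀ g : Gal F, ψ g = Multiplicative.ofAdd
        (ZMod.castHom (by norm_num : (2 : ℕ) ∣ 4) (ZMod 2) (Multiplicative.toAdd (Φ g)))) ∨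
    (∃ Φ : Gal F →* DihedralGroup 4, Continuous Φ ∧ Function.Surjective Φ ∧
      ∀ g : Gal F, ψ g = Multiplicative.ofAdd (theta' (Φ g))) ∨
    (∃ Φ : Gal F →* DihedralGroup 4, Continuous Φ ∧ Function.Surjective Φ ∧
      ∀ g : Gal F, ψ g = Multiplicative.ofAdd (theta'' (Φ g))) := by
  classical
  have h2F : (2 : F) ≠ 0 := Ring.two_ne_zero hchar
  have h2 : (2 : AlgebraicClosure F) ≠ 0 := by
    have := (map_ne_zero (algebraMap F (AlgebraicClosure F))).mpr h2F
    rwa [map_ofNat] at this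
  have hneg : ∀ x : AlgebraicClosure F, x ≠ 0 → -x ≠ x := by
    intro x hx h3; apply h2; apply mul_right_cancel₀ hx; linear_combination -h3
  obtain ⟨δ, d, hδ0, hδ, hg⟩ := kummer hchar ψ hc
  have hp : ∀ g, ψ g = 1 → g δ = δ := fun g h => by rw [hg, h]; simp [zsgn]
  have hn : ∀ g, ψ g ≠ 1 → g δ = -δ := fun g h => by rw [hg]; simp [zsgn, h]
  have hψ : ∀ g, ψ g = Multiplicative.ofAdd (if g δ = δ then 0 else 1 : ZMod 2) := by
    intro g
    by_cases h : ψ g = 1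
    · rw [if_pos (hp g h), h]; rfl
    · rw [if_neg (by rw [hn g h]; exact hneg _ hδ0)]; exact psi_eq _ h
  obtain ⟨g₀, hg₀⟩ := hs (Multiplicative.ofAdd 1)
  have hg₀n : g₀ δ = -δ := hn g₀ (by rw [hg₀]; decide)
  have hd : ∀ b : F, b ^ 2 ≠ d := by
    rintro b rfl
    rw [map_pow] at hδ
    apply hneg δ hδ0
    rw [← hg₀n]
    rcases sq_eq_sq_iff_eq_or_eq_neg.mp hδ with h | h <;> rw [h] <;> simp
  obtain ⟨i, hi'⟩ := IsAlgClosed.exists_pow_nat_eq (-1 : AlgebraicClosure F) (n := 2) (by norm_num)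
  obtain ⟨α, hα⟩ := IsAlgClosed.exists_pow_nat_eq δ (n := 2) (by norm_num)
  have hα0 : α ≠ 0 := by rintro rfl; apply hδ0; rw [← hα]; simp
  have hα4 : α ^ 4 = algebraMap F _ d := by rw [← hδ, ← hα]; ring
  by_cases h1 : ∃ b : F, b ^ 2 = -1
  · left
    obtain ⟨b, hb⟩ := h1
    obtain ⟨Φ, hΦ, hΦs, h⟩ := cyclic_case h2 (i := algebraMap F _ b)
      (by rw [← map_pow, hb]; simp) hα0 hα4 (fun g => by simp) ⟨g₀, by rw [hα, hg₀n]⟩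
    refine ⟨Φ, hΦ, hΦs, fun g => ?_⟩
    rw [h g, hψ, hα]
  right
  push Not at h1
  by_cases h3 : ∀ b : F, b ^ 2 ≠ -d
  · left
    obtain ⟨Φ, hΦ, hΦs, h⟩ := dihedral_case h2 hi' hα0 hα4 h1 hd h3
    refine ⟨Φ, hΦ, hΦs, fun g => ?_⟩
    rw [(h g).1, hψ, hα]
  · right
    push Not at h3
    obtain ⟨y, hy⟩ := h3
    have hA : ∃ a : F, (∀ b : F, b ^ 2 ≠ a) ∧ ∀ b : F, b ^ 2 ≠ -a := by
      by_contra! hcon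
      refine heucl ⟨by push Not; exact h1, fun a => ?_⟩
      by_cases h : ∃ x : F, x ^ 2 = a
      · exact Or.inl h
      · right; push Not at h; exact hcon a h
    obtain ⟨a, ha, hna⟩ := hA
    obtain ⟨β, hβ⟩ := IsAlgClosed.exists_pow_nat_eq (algebraMap F (AlgebraicClosure F) a)
      (n := 4) (by norm_num)
    have hβ0 : β ≠ 0 := by
      rintro rfl
      apply ha 0
      apply (algebraMap F (AlgebraicClosure F)).injective
      rw [← hβ]; simp
    obtain ⟨Φ, hΦ, hΦs, h⟩ := dihedral_case h2 hi' hβ0 hβ h1 ha hna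
    refine ⟨Φ, hΦ, hΦs, fun g => ?_⟩
    rw [(h g).2, hψ]
    have hy0 : algebraMap F (AlgebraicClosure F) y ≠ 0 := by
      rw [map_ne_zero]; rintro rfl
      apply hδ0
      have : d = 0 := by simpa using hy.symm
      rw [this] at hδ; simpa using hδ
    have hsq : δ ^ 2 = (i * algebraMap F _ y) ^ 2 := by
      rw [hδ, mul_pow, hi', ← map_pow, hy]; simp
    have hiff : g δ = δ ↔ g i = i := by
      rcases sq_eq_sq_iff_eq_or_eq_neg.mp hsq with h | h <;> rw [h] <;> simp [hy0]
    simp only [hiff]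
end
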